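/- arXiv:1807.07619 — 4 statements merged into one kernel-verified Lean document; each statement's English description precedes it below -/
import Mathlib

section
/- Let G = (V, E, w) be a finite weighted graph with nonnegative weights and define W(uv) = d_w(u, v) − w(uv) for each edge uv ∈ E, where d_w is the shortest-path distance in G. Then for every decrease-only solution W' of the metric repair problem and every edge e ∈ E, |W(e)| ≤ |W'(e)|. Consequently, for every p with 1 ≤ p < ∞, Σ_{e ∈ E} |W(e)|^p ≤ Σ_{e ∈ E} |W'(e)|^p, i.e., W minimizes the ℓ_p norm among all decrease-only solutions. -/
/-- `e` is the top edge of the broken cycle `c` in the weighted graph `(G, w)`: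
`c` is a cycle, `e` is an edge of `c`, and the weight of `e` exceeds the total
weight of the other (bottom) edges of `c`. -/
def IsTopEdgeOf {V : Type*} [DecidableEq V] (G : SimpleGraph V) (w : Sym2 V → ℝ)
    {u : V} (c : G.Walk u u) (e : Sym2 V) : Prop :=
  c.IsCycle ∧ e ∈ c.edges ∧ ((c.edges.erase e).map w).sum < w e

/-- The weighted graph `(G, w)` has a broken cycle. -/
def HasBrokenCycle {V : Type*} [DecidableEq V] (G : SimpleGraph V)
    (w : Sym2 V → ℝ) : Prop :=
  ∃ (u : V) (c : G.Walk u u) (e : Sym2 V), IsTopEdgeOf G w c e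


/-- Shortest-path distance between `u` and `v` in `(G, w)`: the infimum of the
total `w`-weight of paths from `u` to `v` in `G`. -/
noncomputable def spDist {V : Type*} (G : SimpleGraph V) (w : Sym2 V → ℝ)
    (u v : V) : ℝ :=
  sInf {x : ℝ | ∃ p : G.Walk u v, p.IsPath ∧ x = (p.edges.map w).sum}

/-- A walk in a graph with nonnegative weights has nonnegative total weight. -/
lemma walk_weight_nonneg {V : Type*} {G : SimpleGraph V} {w : Sym2 V → ℝ}
    (hw : ∀ e ∈ G.edgeSet, 0 ≤ w e) {u v : V} (p : G.Walk u v) :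
    0 ≤ (p.edges.map w).sum := by
  refine List.sum_nonneg fun x hx => ?_
  obtain ⟨e, he, rfl⟩ := List.mem_map.1 hx
  exact hw e (p.edges_subset_edgeSet he)

/-- The shortest-path distance between adjacent vertices is at most the weight of the edge. -/
lemma spDist_le_weight {V : Type*} {G : SimpleGraph V} {w : Sym2 V → ℝ}
    (hw : ∀ e ∈ G.edgeSet, 0 ≤ w e) {u v : V} (h : G.Adj u v) :
    spDist G w u v ≤ w s(u, v) := by
  refine csInf_le ⟨0, ?_⟩ ⟨h.toWalk, SimpleGraph.Walk.IsPath.of_adj h, by simp⟩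
  rintro _ ⟨p, -, rfl⟩
  exact walk_weight_nonneg hw p

/-- In a weighted graph satisfying a metric, no edge is heavier than a path joining its ends. -/
lemma weight_le_path_of_not_hasBrokenCycle {V : Type*} [DecidableEq V] {G : SimpleGraph V}
    {w : Sym2 V → ℝ} (hw : ∀ e ∈ G.edgeSet, 0 ≤ w e) (hG : ¬ HasBrokenCycle G w)
    {u v : V} (h : G.Adj u v) {p : G.Walk u v} (hp : p.IsPath) :
    w s(u, v) ≤ (p.edges.map w).sum := by
  by_cases he : s(u, v) ∈ p.edges
  · refine List.single_le_sum (fun x hx => ?_) _ (List.mem_map_of_mem he)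
    obtain ⟨e, he, rfl⟩ := List.mem_map.1 hx
    exact hw e (p.edges_subset_edgeSet he)
  · by_contra! hlt
    refine hG ⟨v, p.cons h.symm, s(v, u), ?_, by simp, ?_⟩
    · exact (p.cons_isCycle_iff h.symm).2 ⟨hp, by rwa [Sym2.eq_swap]⟩
    · simpa [Sym2.eq_swap (a := v)] using hlt

/-- If `(G, w')` satisfies a metric and `w' ≤ w` on edges, then `w'` is bounded on every edge
by the shortest-path distance in `(G, w)`. -/
lemma weight_le_spDist_of_not_hasBrokenCycle {V : Type*} [DecidableEq V] {G : SimpleGraph V}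
    {w w' : Sym2 V → ℝ} (hw' : ∀ e ∈ G.edgeSet, 0 ≤ w' e) (hle : ∀ e ∈ G.edgeSet, w' e ≤ w e)
    (hG : ¬ HasBrokenCycle G w') {u v : V} (h : G.Adj u v) :
    w' s(u, v) ≤ spDist G w u v := by
  refine le_csInf ⟨_, h.toWalk, SimpleGraph.Walk.IsPath.of_adj h, rfl⟩ ?_
  rintro _ ⟨p, hp, rfl⟩
  exact (weight_le_path_of_not_hasBrokenCycle hw' hG h hp).trans
    (List.sum_le_sum fun e he => hle e (p.edges_subset_edgeSet he))

/-- For a finite weighted graph `(V, E, w)` with nonnegative weights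
and `W(uv) = d_w(u,v) - w(uv)`: for every decrease-only solution `W'` of the metric
repair problem we have `|W(e)| ≤ |W'(e)|` on every edge, and consequently for every
`1 ≤ p < ∞`, `∑_{e ∈ E} |W(e)|^p ≤ ∑_{e ∈ E} |W'(e)|^p`; that is, `W` minimizes the
`ℓ_p` norm among all decrease-only solutions. -/
theorem stmt_6 {V : Type*} [Fintype V] [DecidableEq V]
    (G : SimpleGraph V) [Fintype G.edgeSet] (w : Sym2 V → ℝ)
    (hw : ∀ e ∈ G.edgeSet, 0 ≤ w e)
    (W : Sym2 V → ℝ)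
    (hW : ∀ u v, G.Adj u v → W s(u, v) = spDist G w u v - w s(u, v))
    (W' : Sym2 V → ℝ)
    (hW'le : ∀ e ∈ G.edgeSet, W' e ≤ 0)
    (hW'nonneg : ∀ e ∈ G.edgeSet, 0 ≤ w e + W' e)
    (hW'sol : ¬ HasBrokenCycle G (fun e => w e + W' e)) :
    (∀ e ∈ G.edgeSet, |W e| ≤ |W' e|) ∧
    (∀ p : ℝ, 1 ≤ p →
      ∑ e ∈ G.edgeFinset, |W e| ^ p ≤ ∑ e ∈ G.edgeFinset, |W' e| ^ p) := by
  have key : ∀ e ∈ G.edgeSet, |W e| ≤ |W' e| := by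
    intro e he
    induction e with
    | _ u v =>
      have hd := spDist_le_weight hw he
      have hd' := weight_le_spDist_of_not_hasBrokenCycle (w := w) hW'nonneg
        (fun e he => by linarith [hW'le e he]) hW'sol he
      rw [abs_of_nonpos (hW'le _ he), hW u v he, abs_of_nonpos (by linarith)]
      linarith
  refine ⟨key, fun p hp => Finset.sum_le_sum fun e he => ?_⟩
  exact Real.rpow_le_rpow (abs_nonneg _) (key e (SimpleGraph.mem_edgeFinset.1 he)) (by linarith)
end

section
/- Let G = (V, E, w) be a finite weighted graph with nonnegative weights, let k be a natural number, and let e ∈ E. If e is an edge of more than k distinct broken 3-cycles of G (in any role, as top edge or bottom edge), then every solution W of the metric repair problem with |supp(W)| ≤ k satisfies e ∈ supp(W). -/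
/-- In a weighted graph without broken cycles, every triangle satisfies the triangle inequality. -/
theorem weight_le_add_of_not_hasBrokenCycle {V : Type*} [DecidableEq V]
    {G : SimpleGraph V} {w : Sym2 V → ℝ} (h : ¬ HasBrokenCycle G w) {a b c : V}
    (hab : G.Adj a b) (hbc : G.Adj b c) (hca : G.Adj c a) :
    w s(a, b) ≤ w s(b, c) + w s(c, a) := by
  by_contra! hlt
  refine h ⟨a, .cons hab (.cons hbc (.cons hca .nil)), s(a, b), ?_, by simp, by simpa using hlt⟩
  have := hab.ne
  have := hbc.ne
  have := hca.ne
  rw [SimpleGraph.Walk.cons_isCycle_iff]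
  simp_all [SimpleGraph.Walk.isPath_def, eq_comm]

/-- Let `(V, E, w)` be a finite weighted graph with nonnegative
weights, `k : ℕ`, and `uv ∈ E`. If `uv` is an edge of more than `k` distinct broken
3-cycles (in any role, as top or bottom edge; equivalently there are more than `k`
vertices `x` such that the triangle `u v x` is broken), then every solution `W` of
the metric repair problem with `|supp(W)| ≤ k` satisfies `W(uv) ≠ 0`. -/
theorem stmt_8 {V : Type*} [Fintype V] [DecidableEq V]
    (G : SimpleGraph V) (w : Sym2 V → ℝ)
    (hw : ∀ e ∈ G.edgeSet, 0 ≤ w e)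
    (k : ℕ) (u v : V) (huv : G.Adj u v)
    (hmany : k < {x : V | G.Adj u x ∧ G.Adj v x ∧
        (w s(u, x) + w s(v, x) < w s(u, v) ∨
         w s(u, v) + w s(v, x) < w s(u, x) ∨
         w s(u, v) + w s(u, x) < w s(v, x))}.ncard)
    (W : Sym2 V → ℝ)
    (hWnonneg : ∀ e ∈ G.edgeSet, 0 ≤ w e + W e)
    (hWsol : ¬ HasBrokenCycle G (fun e => w e + W e))
    (hWcard : {e | e ∈ G.edgeSet ∧ W e ≠ 0}.ncard ≤ k) :
    W s(u, v) ≠ 0 := by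
  classical
  intro h0
  refine absurd hWcard (not_le.mpr (hmany.trans_le ?_))
  refine Set.ncard_le_ncard_of_injOn
    (fun x => if W s(u, x) ≠ 0 then s(u, x) else s(v, x)) ?_ ?_ ?_
  · rintro x ⟨hux, hvx, hx⟩
    by_cases h : W s(u, x) = 0
    · refine ⟨by simpa [h] using hvx, ?_⟩
      simp only [h, ne_eq, not_true_eq_false, if_false]
      intro hv
      have h1 := weight_le_add_of_not_hasBrokenCycle hWsol huv hvx hux.symm
      have h2 := weight_le_add_of_not_hasBrokenCycle hWsol hux hvx.symm huv.symm
      have h3 := weight_le_add_of_not_hasBrokenCycle hWsol hvx hux.symm huv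
      simp only [Sym2.eq_swap (a := x), Sym2.eq_swap (a := v) (b := u), h, hv, h0] at h1 h2 h3
      rcases hx with hx | hx | hx <;> linarith
    · simpa [h] using hux
  · rintro x ⟨hux, hvx, -⟩ y ⟨huy, hvy, -⟩ hxy
    have := huv.ne
    have := hux.ne
    have := hvx.ne
    have := huy.ne
    have := hvy.ne
    dsimp only at hxy
    split_ifs at hxy <;> simp only [Sym2.eq_iff] at hxy <;> grind
  · exact Set.toFinite _
end

section
/- Let G = (V, E, w) be a finite weighted graph with nonnegative weights, let S ⊆ E, and let M = max_{e ∈ E} w(e). Define w' : E → ℝ by w'(e) = M for e ∈ S and w'(e) = w(e) for e ∉ S, and define w''(uv) = d_{w'}(u, v) for each edge uv ∈ E, where d_{w'} is the shortest-path distance with respect to w'. Then: (i) the weighted graph (V, E, w'') has no broken cycle; and (ii) there exists a solution W of the metric repair problem for (V, E, w) with supp(W) ⊆ S if and only if w''(e) = w(e) for every e ∉ S, in which case W = w'' − w is such a solution. -/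
section

variable {V : Type*} {G : SimpleGraph V} {w : Sym2 V → ℝ}

lemma SimpleGraph.Walk.sum_map_edges_nonneg (hw : ∀ e ∈ G.edgeSet, 0 ≤ w e) {u v : V}
    (p : G.Walk u v) : 0 ≤ (p.edges.map w).sum := by
  apply List.sum_nonneg
  simp only [List.mem_map]
  rintro _ ⟨e, he, rfl⟩
  exact hw e (p.edges_subset_edgeSet he)

lemma SimpleGraph.Walk.le_sum_map_edges (hw : ∀ e ∈ G.edgeSet, 0 ≤ w e) {u v : V}
    (p : G.Walk u v) {e : Sym2 V} (he : e ∈ p.edges) : w e ≤ (p.edges.map w).sum := by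
  apply List.single_le_sum _ _ (List.mem_map_of_mem he)
  simp only [List.mem_map]
  rintro _ ⟨f, hf, rfl⟩
  exact hw f (p.edges_subset_edgeSet hf)

lemma SimpleGraph.Walk.exists_edges_eq_append_cons {u v : V} (p : G.Walk u v) {d : G.Dart}
    (hd : d ∈ p.darts) :
    ∃ (q : G.Walk u d.fst) (r : G.Walk d.snd v), p.edges = q.edges ++ d.edge :: r.edges := by
  induction p with
  | nil => simp at hd
  | cons h p ih =>
    rw [SimpleGraph.Walk.darts_cons, List.mem_cons] at hd
    rcases hd with rfl | hd
    · exact ⟨.nil, p, by simp [SimpleGraph.Dart.edge]⟩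
    · obtain ⟨q, r, hqr⟩ := ih hd
      exact ⟨.cons h q, r, by simp [hqr]⟩

/-- Removing an edge from a closed walk leaves the edges of a walk between its endpoints. -/
lemma SimpleGraph.Walk.exists_perm_edges_erase [DecidableEq V] {u : V} (c : G.Walk u u)
    {e : Sym2 V} (he : e ∈ c.edges) :
    ∃ (x y : V) (p : G.Walk x y), e = s(x, y) ∧ (c.edges.erase e).Perm p.edges := by
  obtain ⟨d, hd, rfl⟩ := List.mem_map.mp he
  obtain ⟨q, r, hqr⟩ := c.exists_edges_eq_append_cons hd
  refine ⟨d.snd, d.fst, r.append q, Sym2.eq_swap, ?_⟩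
  rw [hqr, SimpleGraph.Walk.edges_append]
  refine (List.perm_middle.erase d.edge).trans ?_
  rw [List.erase_cons_head]
  exact List.perm_append_comm

lemma spDist_le_sum_of_isPath (hw : ∀ e ∈ G.edgeSet, 0 ≤ w e) {u v : V} {p : G.Walk u v}
    (hp : p.IsPath) : spDist G w u v ≤ (p.edges.map w).sum := by
  refine csInf_le ⟨0, ?_⟩ ⟨p, hp, rfl⟩
  rintro _ ⟨q, -, rfl⟩
  exact q.sum_map_edges_nonneg hw

lemma spDist_le_sum (hw : ∀ e ∈ G.edgeSet, 0 ≤ w e) {u v : V} (p : G.Walk u v) :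
    spDist G w u v ≤ (p.edges.map w).sum := by
  classical
  refine (spDist_le_sum_of_isPath hw p.bypass_isPath).trans
    ((p.edges_bypass_sublist_edges.map w).sum_le_sum ?_)
  simp only [List.mem_map]
  rintro _ ⟨e, he, rfl⟩
  exact hw e (p.edges_subset_edgeSet he)

lemma spDist_nonneg (hw : ∀ e ∈ G.edgeSet, 0 ≤ w e) (u v : V) : 0 ≤ spDist G w u v := by
  apply Real.sInf_nonneg
  rintro _ ⟨q, -, rfl⟩
  exact q.sum_map_edges_nonneg hw

lemma spDist_le_of_adj (hw : ∀ e ∈ G.edgeSet, 0 ≤ w e) {u v : V} (h : G.Adj u v) :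
    spDist G w u v ≤ w s(u, v) := by
  simpa using spDist_le_sum hw h.toWalk

lemma le_spDist {u v : V} (h : G.Reachable u v) {a : ℝ}
    (ha : ∀ p : G.Walk u v, a ≤ (p.edges.map w).sum) : a ≤ spDist G w u v := by
  obtain ⟨p, hp⟩ := h.exists_isPath
  refine le_csInf ⟨_, p, hp, rfl⟩ ?_
  rintro _ ⟨q, -, rfl⟩
  exact ha q

lemma spDist_triangle (hw : ∀ e ∈ G.edgeSet, 0 ≤ w e) {u v x : V} (huv : G.Reachable u v)
    (hvx : G.Reachable v x) : spDist G w u x ≤ spDist G w u v + spDist G w v x := by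
  rw [← sub_le_iff_le_add]
  refine le_spDist huv fun p ↦ ?_
  rw [sub_le_comm]
  refine le_spDist hvx fun q ↦ ?_
  rw [sub_le_iff_le_add']
  simpa using spDist_le_sum hw (p.append q)

/-- Replacing each edge weight by the distance between its endpoints does not shorten walks
below the distance. -/
lemma spDist_le_sum_of_eq_spDist (hw : ∀ e ∈ G.edgeSet, 0 ≤ w e) {w₂ : Sym2 V → ℝ}
    (hw₂ : ∀ u v, G.Adj u v → w₂ s(u, v) = spDist G w u v) {u v : V} (p : G.Walk u v) :
    spDist G w u v ≤ (p.edges.map w₂).sum := by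
  induction p with
  | nil => simpa using spDist_le_sum hw (SimpleGraph.Walk.nil (G := G))
  | cons h p ih =>
    rw [SimpleGraph.Walk.edges_cons, List.map_cons, List.sum_cons, hw₂ _ _ h]
    exact (spDist_triangle hw h.reachable p.reachable).trans (by gcongr)

lemma not_hasBrokenCycle_of_le_sum [DecidableEq V]
    (h : ∀ (u v : V) (p : G.Walk u v), G.Adj u v → w s(u, v) ≤ (p.edges.map w).sum) :
    ¬ HasBrokenCycle G w := by
  rintro ⟨u, c, e, -, he, hlt⟩
  obtain ⟨x, y, p, rfl, hp⟩ := c.exists_perm_edges_erase he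
  rw [(hp.map w).sum_eq] at hlt
  exact (h x y p (c.edges_subset_edgeSet he)).not_gt hlt

lemma le_sum_of_not_hasBrokenCycle [DecidableEq V] (hw : ∀ e ∈ G.edgeSet, 0 ≤ w e)
    (h : ¬ HasBrokenCycle G w) {u v : V} (huv : G.Adj u v) {p : G.Walk u v} (hp : p.IsPath) :
    w s(u, v) ≤ (p.edges.map w).sum := by
  by_cases hmem : s(u, v) ∈ p.edges
  · exact p.le_sum_map_edges hw hmem
  · by_contra! hlt
    refine h ⟨v, .cons huv.symm p, s(v, u), ?_, by simp, ?_⟩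
    · exact (SimpleGraph.Walk.cons_isCycle_iff p huv.symm).mpr ⟨hp, by rwa [Sym2.eq_swap]⟩
    · rw [SimpleGraph.Walk.edges_cons, List.erase_cons_head, Sym2.eq_swap]
      exact hlt

end

/-- correctness of the `Verifier`, general case. Let `(V, E, w)` be a
finite weighted graph with nonnegative weights, `S ⊆ E`, and `M = max_{e ∈ E} w(e)`.
Let `w'` agree with `w` off `S` and equal `M` on `S`, and let `w''(uv) = d_{w'}(u, v)`
for every edge `uv`. Then (i) `(V, E, w'')` has no broken cycle, and (ii) there is a
solution of the metric repair problem for `(V, E, w)` supported inside `S` iff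
`w''(e) = w(e)` for every edge `e ∉ S`, in which case `W = w'' - w` is such a
solution. -/
theorem stmt_9 {V : Type*} [Fintype V] [DecidableEq V]
    (G : SimpleGraph V) (w : Sym2 V → ℝ)
    (hw : ∀ e ∈ G.edgeSet, 0 ≤ w e)
    (S : Set (Sym2 V)) (hS : S ⊆ G.edgeSet)
    (M : ℝ) (hM : IsGreatest (w '' G.edgeSet) M)
    (w' : Sym2 V → ℝ)
    (hw'S : ∀ e ∈ S, w' e = M) (hw'nS : ∀ e ∉ S, w' e = w e)
    (w'' : Sym2 V → ℝ)
    (hw'' : ∀ u v, G.Adj u v → w'' s(u, v) = spDist G w' u v) :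
    ¬ HasBrokenCycle G w'' ∧
    ((∃ W : Sym2 V → ℝ,
        (∀ e ∈ G.edgeSet, 0 ≤ w e + W e) ∧
        (∀ e ∈ G.edgeSet, W e ≠ 0 → e ∈ S) ∧
        ¬ HasBrokenCycle G (fun e => w e + W e)) ↔
      (∀ e ∈ G.edgeSet, e ∉ S → w'' e = w e)) ∧
    ((∀ e ∈ G.edgeSet, e ∉ S → w'' e = w e) →
      ((∀ e ∈ G.edgeSet, 0 ≤ w e + (w'' e - w e)) ∧
       (∀ e ∈ G.edgeSet, w'' e - w e ≠ 0 → e ∈ S) ∧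
       ¬ HasBrokenCycle G (fun e => w e + (w'' e - w e)))) := by
  have hMub := hM.2
  have hwM : ∀ e ∈ G.edgeSet, w e ≤ M := fun e he ↦ hMub ⟨e, he, rfl⟩
  have hw'0 : ∀ e ∈ G.edgeSet, 0 ≤ w' e := by
    intro e he
    by_cases heS : e ∈ S
    · exact (hw'S e heS).symm ▸ (hw e he).trans (hwM e he)
    · exact (hw'nS e heS).symm ▸ hw e he
  have hmetric : ¬ HasBrokenCycle G w'' := not_hasBrokenCycle_of_le_sum fun u v p huv ↦
    (hw'' u v huv).trans_le (spDist_le_sum_of_eq_spDist hw'0 hw'' p)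
  have hsol : (∀ e ∈ G.edgeSet, e ∉ S → w'' e = w e) →
      ((∀ e ∈ G.edgeSet, 0 ≤ w e + (w'' e - w e)) ∧
       (∀ e ∈ G.edgeSet, w'' e - w e ≠ 0 → e ∈ S) ∧
       ¬ HasBrokenCycle G (fun e => w e + (w'' e - w e))) := by
    intro h
    simp only [add_sub_cancel]
    refine ⟨fun e ↦ ?_, fun e he hne ↦ ?_, hmetric⟩
    · induction e with
      | h u v =>
        intro he
        exact (hw'' u v he).symm ▸ spDist_nonneg hw'0 u v
    · by_contra heS
      exact hne (sub_eq_zero.mpr (h e he heS))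
  refine ⟨hmetric, ⟨?_, fun h ↦ ⟨fun e ↦ w'' e - w e, hsol h⟩⟩, hsol⟩
  rintro ⟨W, hW0, hWS, hW⟩ e he heS
  have hWeq : ∀ f ∈ G.edgeSet, f ∉ S → w f + W f = w f := fun f hf hfS ↦
    add_eq_left.mpr (not_not.mp (mt (hWS f hf) hfS))
  induction e with
  | h u v =>
    have huv : G.Adj u v := he
    rw [hw'' u v huv]
    refine le_antisymm ((spDist_le_of_adj hw'0 huv).trans_eq (hw'nS _ heS)) ?_
    obtain ⟨q, hq⟩ := huv.reachable.exists_isPath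
    refine le_csInf ⟨_, q, hq, rfl⟩ ?_
    rintro _ ⟨p, hp, rfl⟩
    by_cases hpS : ∃ f ∈ p.edges, f ∈ S
    · obtain ⟨f, hfp, hfS⟩ := hpS
      exact (hwM _ he).trans ((hw'S f hfS).symm.trans_le (p.le_sum_map_edges hw'0 hfp))
    · push Not at hpS
      have hle := le_sum_of_not_hasBrokenCycle hW0 hW huv hp
      rw [hWeq _ he heS] at hle
      refine hle.trans_eq (congrArg List.sum (List.map_congr_left fun f hf ↦ ?_))
      rw [hWeq f (p.edges_subset_edgeSet hf) (hpS f hf), hw'nS f (hpS f hf)]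
end

section
/- Fix integers n and k with 1 ≤ k and 2k < n, and let D be the associated gadget matrix. Then every increase-only repair D' of D differs from D in at least k(k−1)/2 unordered off-diagonal pairs {i, j} (equivalently, at least k(k−1) entries counting symmetric positions separately). Hence the minimum number of unordered off-diagonal pairs modified by an increase-only repair of D is exactly k(k−1)/2. -/
/-- The gadget matrix associated with `k` (used on indices `1, …, n` with
`1 ≤ k` and `2k < n`): `D i j = 0` if `i = j` or both `i, j ≤ k`;
`D i j = 1` if both `i, j > k`; and `D i j = k + 1 - min i j` otherwise. -/
noncomputable def gadget (k : ℕ) (i j : ℕ) : ℝ :=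
  if i = j then 0
  else if i ≤ k ∧ j ≤ k then 0
  else if k < i ∧ k < j then 1
  else (k : ℝ) + 1 - (min i j : ℕ)

/-- `D'` is an increase-only repair of the gadget matrix on the indices `{1, …, n}`:
symmetric with zero diagonal, entrywise at least the gadget matrix, and satisfying
all triangle inequalities. -/
def IsIncreaseOnlyRepair (n k : ℕ) (D' : ℕ → ℕ → ℝ) : Prop :=
  (∀ i ∈ Finset.Icc 1 n, ∀ j ∈ Finset.Icc 1 n, D' i j = D' j i) ∧
  (∀ i ∈ Finset.Icc 1 n, D' i i = 0) ∧
  (∀ i ∈ Finset.Icc 1 n, ∀ j ∈ Finset.Icc 1 n, gadget k i j ≤ D' i j) ∧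
  (∀ i ∈ Finset.Icc 1 n, ∀ j ∈ Finset.Icc 1 n, ∀ l ∈ Finset.Icc 1 n,
    D' i j ≤ D' i l + D' l j)

/-- The pairs `i < j` in `{1, …, k}`. -/
def lowPairs (k : ℕ) : Set (ℕ × ℕ) := {p | 1 ≤ p.1 ∧ p.1 < p.2 ∧ p.2 ≤ k}

theorem ncard_lowPairs (k : ℕ) : (lowPairs k).ncard = k * (k - 1) / 2 := by
  have h : lowPairs k = (((Finset.range k).sigma fun j => Finset.range j).image
      fun x => (x.2 + 1, x.1 + 1) : Finset (ℕ × ℕ)) := by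
    ext ⟨i, j⟩
    simp only [lowPairs, Set.mem_ofPred_eq, Finset.coe_image, Set.mem_image, Finset.mem_coe,
      Finset.mem_sigma, Finset.mem_range, Prod.mk.injEq]
    constructor
    · rintro ⟨h1, h2, h3⟩
      exact ⟨⟨j - 1, i - 1⟩, by dsimp only; omega, by dsimp only; omega, by dsimp only; omega⟩
    · rintro ⟨⟨a, b⟩, ⟨h1, h2⟩, h3, h4⟩
      dsimp only at h1 h2 h3 h4
      omega
  rw [h, Set.ncard_coe_finset, Finset.card_image_of_injective, Finset.card_sigma]
  · simp [Finset.sum_range_id]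
  · rintro ⟨a, b⟩ ⟨c, d⟩ h
    simp only [Prod.mk.injEq, Nat.add_right_cancel_iff] at h
    obtain ⟨rfl, rfl⟩ := h
    rfl

theorem gadget_of_le {k i j : ℕ} (hi : i ≤ k) (hj : j ≤ k) : gadget k i j = 0 := by
  simp [gadget, hi, hj]

theorem gadget_of_le_of_lt {k i j : ℕ} (hi : i ≤ k) (hj : k < j) :
    gadget k i j = k + 1 - i := by
  have hij : i < j := by omega
  simp [gadget, hi, hij.ne, hij.le, hj.not_ge, hi.not_gt]

theorem gadget_comm (k i j : ℕ) : gadget k i j = gadget k j i := by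
  simp only [gadget, min_comm i j, eq_comm (a := i), and_comm]

/-- The pairs on which `D'` differs from the gadget matrix. -/
def modifiedPairs (n k : ℕ) (D' : ℕ → ℕ → ℝ) : Set (ℕ × ℕ) :=
  {p | 1 ≤ p.1 ∧ p.1 < p.2 ∧ p.2 ≤ n ∧ D' p.1 p.2 ≠ gadget k p.1 p.2}

theorem modifiedPairs_finite (n k : ℕ) (D' : ℕ → ℕ → ℝ) : (modifiedPairs n k D').Finite :=
  ((Set.finite_Iic n).prod (Set.finite_Iic n)).subset fun p hp => by
    obtain ⟨-, h2, h3, -⟩ := hp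
    exact ⟨h2.le.trans h3, h3⟩

/-- A repair that leaves `(i, j)` unmodified, where `i < j ≤ k`, must modify `(j, l)` for every
`l > k`. -/
theorem IsIncreaseOnlyRepair.ne_of_eq {n k : ℕ} {D' : ℕ → ℕ → ℝ}
    (h : IsIncreaseOnlyRepair n k D') {i j l : ℕ} (hi : 1 ≤ i) (hij : i < j) (hj : j ≤ k)
    (hl : k < l) (hln : l ≤ n) (he : D' i j = gadget k i j) : D' j l ≠ gadget k j l := by
  intro he'
  have hi' : i ∈ Finset.Icc 1 n := Finset.mem_Icc.2 (by omega)
  have hj' : j ∈ Finset.Icc 1 n := Finset.mem_Icc.2 (by omega)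
  have hl' : l ∈ Finset.Icc 1 n := Finset.mem_Icc.2 (by omega)
  have h1 := h.2.2.1 i hi' l hl'
  have h2 := h.2.2.2 i hi' l hl' j hj'
  rw [gadget_of_le (by omega) hj] at he
  rw [gadget_of_le_of_lt hj hl] at he'
  rw [gadget_of_le_of_lt (by omega) hl] at h1
  have h3 : (i : ℝ) < j := by exact_mod_cast hij
  linarith

theorem IsIncreaseOnlyRepair.le_ncard_modifiedPairs {n k : ℕ} (hn : 2 * k < n)
    {D' : ℕ → ℕ → ℝ} (h : IsIncreaseOnlyRepair n k D') :
    k * (k - 1) / 2 ≤ (modifiedPairs n k D').ncard := by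
  classical
  rw [← ncard_lowPairs]
  refine Set.ncard_le_ncard_of_injOn
    (fun p => if D' p.1 p.2 ≠ gadget k p.1 p.2 then p else (p.2, k + p.1)) ?_ ?_
    (modifiedPairs_finite n k D')
  · rintro ⟨i, j⟩ ⟨h1, h2, h3⟩
    dsimp only at h1 h2 h3 ⊢
    split_ifs with he
    · exact ⟨h1, h2, by dsimp only; omega, he⟩
    · exact ⟨by dsimp only; omega, by dsimp only; omega, by dsimp only; omega,
        h.ne_of_eq h1 h2 h3 (by omega) (by omega) (not_not.1 he)⟩
  · rintro ⟨i, j⟩ ⟨h1, h2, h3⟩ ⟨i', j'⟩ ⟨h1', h2', h3'⟩ he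
    dsimp only at h1 h2 h3 h1' h2' h3' he
    split_ifs at he <;> simp only [Prod.mk.injEq] at he ⊢ <;> omega

/-- The repair replacing the zero block on `{1, …, k}` by the path metric. -/
noncomputable def pathRepair (k i j : ℕ) : ℝ :=
  if i ≤ k ∧ j ≤ k then |(i : ℝ) - j| else gadget k i j

theorem isIncreaseOnlyRepair_pathRepair (n k : ℕ) :
    IsIncreaseOnlyRepair n k (pathRepair k) := by
  refine ⟨fun i _ j _ => ?_, fun i _ => ?_, fun i _ j _ => ?_, fun i _ j _ l _ => ?_⟩
  · simp only [pathRepair, and_comm, abs_sub_comm (i : ℝ), gadget_comm k i]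
  · simp [pathRepair, gadget]
  · unfold pathRepair
    split_ifs with h
    · rw [gadget_of_le h.1 h.2]
      exact abs_nonneg _
    · exact le_rfl
  · have low : ∀ a ≤ k, (a : ℝ) ≤ k := fun a ha => by exact_mod_cast ha
    have cross : ∀ a ≤ k, ∀ b, k < b → pathRepair k a b = k + 1 - a := fun a ha b hb => by
      rw [pathRepair, if_neg (by omega), gadget_of_le_of_lt ha hb]
    have cross' : ∀ a ≤ k, ∀ b, k < b → pathRepair k b a = k + 1 - a := fun a ha b hb => by
      rw [pathRepair, if_neg (by omega), gadget_comm, gadget_of_le_of_lt ha hb]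
    have inner : ∀ a ≤ k, ∀ b ≤ k, pathRepair k a b = |(a : ℝ) - b| := fun a ha b hb =>
      if_pos ⟨ha, hb⟩
    have outer : ∀ a, k < a → ∀ b, k < b → pathRepair k a b = if a = b then 0 else 1 :=
      fun a ha b hb => by simp [pathRepair, gadget, ha, hb, ha.not_ge]
    rcases le_or_gt i k with hi | hi <;> rcases le_or_gt j k with hj | hj <;>
      rcases le_or_gt l k with hl | hl <;>
      simp only [cross, cross', inner, outer, hi, hj, hl]
    · exact abs_sub_le _ _ _
    · have := low i hi
      have := low j hj
      rw [abs_le]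
      constructor <;> linarith
    · linarith [neg_abs_le ((i : ℝ) - l)]
    · split_ifs <;> linarith
    · linarith [le_abs_self ((l : ℝ) - j)]
    · split_ifs <;> linarith
    · have := low l hl
      split_ifs <;> linarith
    · grind

theorem modifiedPairs_pathRepair {n k : ℕ} (hn : k ≤ n) :
    modifiedPairs n k (pathRepair k) = lowPairs k := by
  ext ⟨i, j⟩
  simp only [modifiedPairs, lowPairs, Set.mem_ofPred_eq]
  refine ⟨fun ⟨h1, h2, h3, h4⟩ => ⟨h1, h2, ?_⟩, fun ⟨h1, h2, h3⟩ => ⟨h1, h2, h3.trans hn, ?_⟩⟩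
  · by_contra hj
    exact h4 (if_neg fun h => hj h.2)
  · rw [gadget_of_le (by omega) h3, pathRepair, if_pos ⟨by omega, h3⟩, abs_ne_zero, sub_ne_zero]
    exact_mod_cast h2.ne

/-- For `1 ≤ k` and `2k < n`, every increase-only repair of the
gadget matrix differs from it in at least `k(k-1)/2` unordered off-diagonal pairs;
hence the minimum number of unordered off-diagonal pairs modified by an
increase-only repair of the gadget matrix is exactly `k(k-1)/2`. -/
theorem stmt_14 (n k : ℕ) (hk : 1 ≤ k) (hn : 2 * k < n) :
    (∀ D' : ℕ → ℕ → ℝ, IsIncreaseOnlyRepair n k D' →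
      k * (k - 1) / 2 ≤
        {p : ℕ × ℕ | 1 ≤ p.1 ∧ p.1 < p.2 ∧ p.2 ≤ n ∧
          D' p.1 p.2 ≠ gadget k p.1 p.2}.ncard) ∧
    IsLeast {m : ℕ | ∃ D' : ℕ → ℕ → ℝ, IsIncreaseOnlyRepair n k D' ∧
        {p : ℕ × ℕ | 1 ≤ p.1 ∧ p.1 < p.2 ∧ p.2 ≤ n ∧
          D' p.1 p.2 ≠ gadget k p.1 p.2}.ncard = m}
      (k * (k - 1) / 2) := by
  have hle : ∀ D' : ℕ → ℕ → ℝ, IsIncreaseOnlyRepair n k D' →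
      k * (k - 1) / 2 ≤ (modifiedPairs n k D').ncard := fun _ h => h.le_ncard_modifiedPairs hn
  refine ⟨hle, ⟨pathRepair k, isIncreaseOnlyRepair_pathRepair n k, ?_⟩, ?_⟩
  · exact (congrArg Set.ncard (modifiedPairs_pathRepair (by omega))).trans (ncard_lowPairs k)
  · rintro m ⟨D', h, rfl⟩
    exact hle D' h
end
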